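/- arXiv:1106.2190 — 4 statements merged into one kernel-verified Lean document; each statement's English description precedes it below -/
import Mathlib

section
/- Let a ≤ b be reals, Δ > 0, and let P*, P : [a,b] → ℝ be monotone nondecreasing functions. Suppose that for every natural number n with a + nΔ ≤ b one has P*(a + nΔ) ≥ P(min{a + (n+1)Δ, b}). Then P*(γ) ≥ P(γ) for every γ ∈ [a,b]. -/
theorem stmt_10 (a b Δ : ℝ) (hab : a ≤ b) (hΔ : 0 < Δ)
    (Pstar P : ℝ → ℝ)
    (hPstar : MonotoneOn Pstar (Set.Icc a b)) (hP : MonotoneOn P (Set.Icc a b))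
    (hgrid : ∀ n : ℕ, a + n * Δ ≤ b →
      P (min (a + (n + 1) * Δ) b) ≤ Pstar (a + n * Δ)) :
    ∀ γ ∈ Set.Icc a b, P γ ≤ Pstar γ := by
  rintro γ ⟨haγ, hγb⟩
  set n : ℕ := ⌊(γ - a) / Δ⌋₊
  have hlow : a + n * Δ ≤ γ := by
    have h := (le_div_iff₀ hΔ).1 (Nat.floor_le (div_nonneg (sub_nonneg.2 haγ) hΔ.le))
    linarith
  have hupp : γ ≤ a + (n + 1) * Δ := by
    have h := (div_lt_iff₀ hΔ).1 (Nat.lt_floor_add_one ((γ - a) / Δ))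
    linarith
  have hγmin : γ ≤ min (a + (n + 1) * Δ) b := le_min hupp hγb
  have hnΔ : a ≤ a + n * Δ := le_add_of_nonneg_right (by positivity)
  calc P γ ≤ P (min (a + (n + 1) * Δ) b) :=
        hP ⟨haγ, hγb⟩ ⟨haγ.trans hγmin, min_le_right _ _⟩ hγmin
    _ ≤ Pstar (a + n * Δ) := hgrid n (hlow.trans hγb)
    _ ≤ Pstar γ := hPstar ⟨hnΔ, hlow.trans hγb⟩ ⟨haγ, hγb⟩ hlow
end

section
/- Let C ⊆ F₂²³ be the span of the eleven Golay stabilizer generator vectors specified in the context. Then C is self-orthogonal, i.e., C ⊆ C⊥, and consequently dim C⊥ = 12 while dim C = 11, so that dim C⊥ − dim C = 1 (the CSS quantum code built from C encodes exactly one logical qubit). -/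
def golaySupports : Fin 11 → Finset (Fin 23) :=
  ![{1,4,7,8,9,10,11,22}, {0,3,6,7,8,9,10,21}, {1,2,4,5,6,10,11,20},
    {0,1,3,4,5,9,10,19}, {0,1,2,3,7,10,11,18}, {0,2,4,6,7,8,11,17},
    {3,4,5,6,8,9,11,16}, {2,3,4,5,7,8,10,15}, {1,2,3,4,6,7,9,14},
    {0,1,2,3,5,6,8,13}, {0,2,5,8,9,10,11,12}]

def golayGen (i : Fin 11) : Fin 23 → ZMod 2 := fun j => if j ∈ golaySupports i then 1 else 0

def golayC : Submodule (ZMod 2) (Fin 23 → ZMod 2) :=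
  Submodule.span (ZMod 2) (Set.range golayGen)

def golayDual : Submodule (ZMod 2) (Fin 23 → ZMod 2) where
  carrier := {u | ∀ w ∈ golayC, ∑ i, u i * w i = 0}
  zero_mem' := by intro w _; simp
  add_mem' := by
    intro u v hu hv w hw
    simp only [Set.mem_setOf_eq] at hu hv ⊢
    simp only [Pi.add_apply, add_mul, Finset.sum_add_distrib, hu w hw, hv w hw, add_zero]
  smul_mem' := by
    intro c u hu w hw
    simp only [Set.mem_setOf_eq] at hu ⊢
    simp only [Pi.smul_apply, smul_eq_mul, mul_assoc, ← Finset.mul_sum, hu w hw, mul_zero]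

theorem golayGen_dotProduct_golayGen (i j : Fin 11) : golayGen i ⬝ᵥ golayGen j = 0 := by
  revert i j
  decide +kernel

/-- The last eleven coordinates of the generators, read backwards, form an identity matrix. -/
theorem golayGen_rev_castLE (i j : Fin 11) :
    golayGen i (Fin.rev (Fin.castLE (by decide) j)) =
      (Pi.single i 1 : Fin 11 → ZMod 2) j := by
  revert i j
  decide +kernel

theorem linearIndependent_golayGen : LinearIndependent (ZMod 2) golayGen := by
  refine LinearIndependent.of_comp (LinearMap.funLeft (ZMod 2) (ZMod 2)
    fun j : Fin 11 => Fin.rev (Fin.castLE (by decide) j : Fin 23)) ?_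
  convert Pi.linearIndependent_single_one (Fin 11) (ZMod 2) using 1
  ext i j
  exact golayGen_rev_castLE i j

theorem mem_golayDual_iff (u : Fin 23 → ZMod 2) :
    u ∈ golayDual ↔ ∀ i, golayGen i ⬝ᵥ u = 0 := by
  refine ⟨fun hu i => ?_, fun hu w hw => ?_⟩
  · rw [dotProduct_comm]
    exact hu _ (Submodule.subset_span ⟨i, rfl⟩)
  · change u ⬝ᵥ w = 0
    induction hw using Submodule.span_induction with
    | mem x hx => obtain ⟨i, rfl⟩ := hx; rw [dotProduct_comm, hu]
    | zero => exact dotProduct_zero u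
    | add x y _ _ hx hy => rw [dotProduct_add, hx, hy, add_zero]
    | smul a x _ hx => rw [dotProduct_smul, hx, smul_zero]

theorem golayC_le_golayDual : golayC ≤ golayDual := by
  rw [golayC, Submodule.span_le]
  rintro _ ⟨j, rfl⟩
  exact (mem_golayDual_iff _).2 fun i => golayGen_dotProduct_golayGen i j

theorem golayDual_eq_ker : golayDual = LinearMap.ker (Matrix.of golayGen).mulVecLin := by
  ext u
  rw [mem_golayDual_iff, LinearMap.mem_ker, funext_iff]
  rfl

theorem finrank_golayC : Module.finrank (ZMod 2) golayC = 11 :=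
  (finrank_span_eq_card linearIndependent_golayGen).trans (Fintype.card_fin 11)

theorem finrank_golayDual : Module.finrank (ZMod 2) golayDual = 12 := by
  have hrank : (Matrix.of golayGen).rank = 11 :=
    (LinearIndependent.rank_matrix (M := Matrix.of golayGen) linearIndependent_golayGen).trans
      (Fintype.card_fin 11)
  have h := LinearMap.finrank_range_add_finrank_ker (Matrix.of golayGen).mulVecLin
  rw [← golayDual_eq_ker, ← Matrix.rank, hrank, Module.finrank_fin_fun] at h
  omega

theorem stmt_12 :
    golayC ≤ golayDual ∧
    Module.finrank (ZMod 2) golayDual = 12 ∧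
    Module.finrank (ZMod 2) golayC = 11 ∧
    Module.finrank (ZMod 2) golayDual - Module.finrank (ZMod 2) golayC = 1 :=
  ⟨golayC_le_golayDual, finrank_golayDual, finrank_golayC, by
    rw [finrank_golayDual, finrank_golayC]⟩
end

section
/- Let C ⊆ F₂²³ be the 11-dimensional code specified in the context, and for a coset u + C of C in F₂²³ let its minimal weight be the minimum Hamming weight of its elements. Then among the 2¹² cosets of C, the number of cosets with minimal weight w, for w = 0, 1, 2, 3, 4, 5, 6, 7, is respectively 1, 23, 253, 1771, 1771, 253, 23, 1, and no coset has minimal weight greater than 7. -/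
/-- The minimal Hamming weight among representatives of a coset of `golayC`. -/
noncomputable def minWtC (q : (Fin 23 → ZMod 2) ⧸ golayC) : ℕ :=
  sInf {n | ∃ v : Fin 23 → ZMod 2,
    (Submodule.Quotient.mk v : (Fin 23 → ZMod 2) ⧸ golayC) = q ∧ hammingNorm v = n}

/-- The vector in `F₂²³` whose coordinates are the binary digits of `n`. -/
def bitVector (n : ℕ) : Fin 23 → ZMod 2 := fun j => if n.testBit j then 1 else 0

theorem bitVector_zero : bitVector 0 = 0 := by
  ext j
  simp [bitVector]

theorem bitVector_xor (m n : ℕ) : bitVector (m ^^^ n) = bitVector m + bitVector n := by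
  ext j
  simp only [bitVector, Nat.testBit_xor, Pi.add_apply]
  cases m.testBit j <;> cases n.testBit j <;> decide

/-- The number of ones among the lowest `k` binary digits of `n`. -/
def bitCount : ℕ → ℕ → ℕ
  | 0, _ => 0
  | k + 1, n => bitCount k n + (n >>> k) % 2

theorem bitCount_eq_sum (k n : ℕ) : bitCount k n = ∑ j ∈ Finset.range k, (n >>> j) % 2 := by
  induction k with
  | zero => rfl
  | succ k ih => rw [bitCount, ih, Finset.sum_range_succ]

theorem hammingNorm_bitVector (n : ℕ) : hammingNorm (bitVector n) = bitCount 23 n := by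
  rw [bitCount_eq_sum, hammingNorm, Finset.card_filter, Finset.sum_range]
  refine Finset.sum_congr rfl fun j _ => ?_
  have hmod := Nat.mod_two_eq_zero_or_one (n >>> j.1)
  rcases hmod with h | h <;> simp [bitVector, Nat.testBit, Nat.one_and_eq_mod_two, h]

/-- The binary encodings of the generators of `golayC`. -/
def golayBits : List ℕ :=
  [4198290, 2099145, 1051766, 525883, 265359, 133589, 68472, 34236, 17118, 8559, 7973]

/-- Whether every vector in the coset of `bitVector n` modulo the span of the vectors encoded in the
list is zero or has Hamming weight between 8 and 16. -/
def weightCheck : List ℕ → ℕ → Bool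
  | [], n => n == 0 || (8 ≤ bitCount 23 n && bitCount 23 n ≤ 16)
  | g :: l, n => weightCheck l n && weightCheck l (n ^^^ g)

theorem hammingNorm_of_weightCheck {l : List ℕ} {n : ℕ} (h : weightCheck l n = true)
    {v : Fin 23 → ZMod 2} (hv : v ∈ Submodule.span (ZMod 2) {x | ∃ g ∈ l, x = bitVector g}) :
    bitVector n + v = 0 ∨
      8 ≤ hammingNorm (bitVector n + v) ∧ hammingNorm (bitVector n + v) ≤ 16 := by
  induction l generalizing n v with
  | nil =>
    obtain rfl : v = 0 := by simpa using hv
    rw [add_zero, hammingNorm_bitVector]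
    simp only [weightCheck, Bool.or_eq_true, beq_iff_eq, Bool.and_eq_true, decide_eq_true_eq] at h
    exact h.imp_left fun h0 => by rw [h0, bitVector_zero]
  | cons g l ih =>
    simp only [weightCheck, Bool.and_eq_true] at h
    have hset : {x | ∃ g' ∈ g :: l, x = bitVector g'} =
        insert (bitVector g) {x | ∃ g' ∈ l, x = bitVector g'} := by
      ext x
      simp
    rw [hset, Submodule.mem_span_insert] at hv
    obtain ⟨a, z, hz, rfl⟩ := hv
    obtain rfl | rfl : a = 0 ∨ a = 1 := by revert a; decide
    · simpa using ih h.1 hz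
    · simpa [bitVector_xor, add_assoc] using ih h.2 hz

theorem golayGen_eq_bitVector (i : Fin 11) : golayGen i = bitVector (golayBits.get i) := by
  revert i
  decide +kernel

theorem golayC_weight {c : Fin 23 → ZMod 2} (hc : c ∈ golayC) (h0 : c ≠ 0) :
    8 ≤ hammingNorm c ∧ hammingNorm c ≤ 16 := by
  have hcheck : weightCheck golayBits 0 = true := by decide +kernel
  have hsub : Set.range golayGen ⊆ {x | ∃ g ∈ golayBits, x = bitVector g} := by
    rintro _ ⟨i, rfl⟩
    exact ⟨_, List.get_mem _ _, golayGen_eq_bitVector i⟩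
  have h := hammingNorm_of_weightCheck hcheck (Submodule.span_mono hsub hc)
  rw [bitVector_zero, zero_add] at h
  exact h.resolve_left h0

theorem card_quotient_golayC : Nat.card ((Fin 23 → ZMod 2) ⧸ golayC) = 4096 := by
  have hC : Nat.card golayC = 2 ^ 11 := by
    rw [Module.natCard_eq_pow_finrank (K := ZMod 2), golayC,
      finrank_span_eq_card linearIndependent_golayGen]
    simp
  have h := Submodule.card_eq_card_quotient_mul_card golayC
  rw [hC] at h
  rw [Nat.card_eq_fintype_card, Fintype.card_fun, ZMod.card, Fintype.card_fin] at h
  lia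

/-- A vector over `F₂` is determined by its support. -/
def supportEquiv (ι : Type*) [Fintype ι] [DecidableEq ι] : (ι → ZMod 2) ≃ Finset ι where
  toFun v := {i | v i ≠ 0}
  invFun s i := if i ∈ s then 1 else 0
  left_inv v := by
    ext i
    have h : ∀ a : ZMod 2, (if a ≠ 0 then 1 else 0) = a := by decide
    simpa using h (v i)
  right_inv s := by
    ext i
    simp

section HammingNorm

variable {ι : Type*} [Fintype ι]

theorem card_hammingNorm_eq (w : ℕ) :
    Nat.card {v : ι → ZMod 2 // hammingNorm v = w} = (Fintype.card ι).choose w := by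
  classical
  rw [← Fintype.card_finset_len, ← Nat.card_eq_fintype_card]
  exact Nat.card_congr ((supportEquiv ι).subtypeEquiv fun v => Iff.rfl)

theorem hammingNorm_add_le (u v : ι → ZMod 2) :
    hammingNorm (u + v) ≤ hammingNorm u + hammingNorm v := by
  have h := hammingDist_triangle u 0 v
  rwa [hammingDist_zero_right, hammingDist_zero_left, hammingDist_eq_hammingNorm,
    ZModModule.neg_eq_self] at h

theorem hammingNorm_one_add (v : ι → ZMod 2) :
    hammingNorm (1 + v) + hammingNorm v = Fintype.card ι := by
  have h : ∀ a : ZMod 2, 1 + a ≠ 0 ↔ ¬ a ≠ 0 := by decide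
  simp only [hammingNorm, Pi.add_apply, Pi.one_apply, h]
  rw [add_comm]
  exact Finset.card_filter_add_card_filter_not _

/-- The support of a vector can be enlarged to any prescribed size. -/
theorem exists_hammingNorm_eq_and_add {v : ι → ZMod 2} {n : ℕ} (hv : hammingNorm v ≤ n)
    (hn : n ≤ Fintype.card ι) :
    ∃ u : ι → ZMod 2, hammingNorm u = n ∧ hammingNorm (u + v) + hammingNorm v = n := by
  classical
  obtain ⟨t, hst, ht⟩ := Finset.exists_superset_card_eq (s := supportEquiv ι v) hv hn
  refine ⟨(supportEquiv ι).symm t, ?_, ?_⟩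
  · exact (congrArg Finset.card ((supportEquiv ι).apply_symm_apply t)).trans ht
  · have hdiff : supportEquiv ι ((supportEquiv ι).symm t + v) = t \ supportEquiv ι v := by
      have h : ∀ a : ZMod 2, 1 + a ≠ 0 ↔ a = 0 := by decide
      ext i
      have hi := @hst i
      by_cases hit : i ∈ t <;> simp_all [supportEquiv]
    rw [← ht, ← Finset.card_sdiff_add_card_eq_card hst, ← hdiff]
    rfl

end HammingNorm

theorem golayC_mk_eq_iff {u v : Fin 23 → ZMod 2} :
    (Submodule.Quotient.mk u : _ ⧸ golayC) = Submodule.Quotient.mk v ↔ u + v ∈ golayC := by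
  rw [Submodule.Quotient.eq, ZModModule.sub_eq_add]

theorem eq_of_mk_eq {u v : Fin 23 → ZMod 2}
    (h : (Submodule.Quotient.mk u : _ ⧸ golayC) = Submodule.Quotient.mk v)
    (hw : hammingNorm u + hammingNorm v < 8) : u = v := by
  by_contra hne
  have h0 : u + v ≠ 0 := by rwa [← ZModModule.sub_eq_add, sub_ne_zero]
  have := (golayC_weight (golayC_mk_eq_iff.1 h) h0).1
  have := hammingNorm_add_le u v
  lia

theorem seven_le_of_mk_eq_one_add {u v : Fin 23 → ZMod 2}
    (h : (Submodule.Quotient.mk u : _ ⧸ golayC) = Submodule.Quotient.mk (1 + v)) :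
    7 ≤ hammingNorm u + hammingNorm v := by
  have hle : hammingNorm (u + (1 + v)) ≤ 16 := by
    by_cases h0 : u + (1 + v) = 0
    · simp [h0]
    · exact (golayC_weight (golayC_mk_eq_iff.1 h) h0).2
  have hcompl := hammingNorm_one_add (u + v)
  rw [add_left_comm, Fintype.card_fin] at hcompl
  have := hammingNorm_add_le u v
  lia

/-- Every coset of `golayC` contains a vector of weight at most 3 or the complement of one. -/
theorem exists_leader (q : (Fin 23 → ZMod 2) ⧸ golayC) :
    ∃ e : Fin 23 → ZMod 2, hammingNorm e ≤ 3 ∧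
      (q = Submodule.Quotient.mk e ∨ q = Submodule.Quotient.mk (1 + e)) := by
  let T := Σ w : Fin 4, {e : Fin 23 → ZMod 2 // hammingNorm e = w}
  have hT (e : T) : hammingNorm e.2.1 ≤ 3 := by
    have := e.2.2
    lia
  have hT_ext {e e' : T} (h : e.2.1 = e'.2.1) : e = e' := by
    obtain ⟨w, e, he⟩ := e
    obtain ⟨w', e', he'⟩ := e'
    obtain rfl : e = e' := h
    obtain rfl : w = w' := Fin.ext (he.symm.trans he')
    rfl
  have hcard : Nat.card T = 2048 := by
    rw [Nat.card_sigma]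
    simp only [card_hammingNorm_eq, Fintype.card_fin]
    decide
  let f : T ⊕ T → (Fin 23 → ZMod 2) ⧸ golayC :=
    Sum.elim (fun e => Submodule.Quotient.mk e.2.1) (fun e => Submodule.Quotient.mk (1 + e.2.1))
  have hf : Function.Injective f := by
    refine Function.Injective.sumElim ?_ ?_ ?_
    · intro e e' h
      exact hT_ext (eq_of_mk_eq h (by have := hT e; have := hT e'; lia))
    · intro e e' h
      simp only [Submodule.Quotient.mk_add, add_right_inj] at h
      exact hT_ext (eq_of_mk_eq h (by have := hT e; have := hT e'; lia))
    · intro e e' h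
      have := seven_le_of_mk_eq_one_add h
      have := hT e
      have := hT e'
      lia
  have hbij := hf.bijective_of_nat_card_le
    (by rw [card_quotient_golayC, Nat.card_sum, hcard])
  obtain ⟨e | e, rfl⟩ := hbij.2 q
  · exact ⟨e.2.1, hT e, Or.inl rfl⟩
  · exact ⟨e.2.1, hT e, Or.inr rfl⟩

theorem minWtC_eq {q : (Fin 23 → ZMod 2) ⧸ golayC} {n : ℕ} (v : Fin 23 → ZMod 2)
    (hv : Submodule.Quotient.mk v = q) (hvn : hammingNorm v ≤ n)
    (hmin : ∀ u : Fin 23 → ZMod 2, Submodule.Quotient.mk u = q → n ≤ hammingNorm u) :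
    minWtC q = n := by
  refine IsLeast.csInf_eq ⟨⟨v, hv, hvn.antisymm (hmin v hv)⟩, ?_⟩
  rintro _ ⟨u, hu, rfl⟩
  exact hmin u hu

theorem minWtC_mk {e : Fin 23 → ZMod 2} (he : hammingNorm e ≤ 3) :
    minWtC (Submodule.Quotient.mk e) = hammingNorm e := by
  refine minWtC_eq e rfl le_rfl fun u hu => ?_
  by_contra! hlt
  have := eq_of_mk_eq hu (by lia)
  simp [this] at hlt

theorem minWtC_mk_one_add {e : Fin 23 → ZMod 2} (he : hammingNorm e ≤ 3) :
    minWtC (Submodule.Quotient.mk (1 + e)) = 7 - hammingNorm e := by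
  obtain ⟨f, hf, hfe⟩ := exists_hammingNorm_eq_and_add (v := e) (n := 4) (by lia) (by simp)
  obtain ⟨e', he', h | h⟩ := exists_leader (Submodule.Quotient.mk f)
  · have := eq_of_mk_eq h (by lia)
    simp only [this] at hf
    lia
  · refine minWtC_eq (f + e + e') ?_ ?_ fun u hu => ?_
    · rw [golayC_mk_eq_iff] at h ⊢
      have : f + e + e' + (1 + e) = f + (1 + e') + (e + e) := by ring
      rwa [this, ZModModule.add_self, add_zero]
    · have := hammingNorm_add_le (f + e) e'
      lia
    · have := seven_le_of_mk_eq_one_add hu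
      lia

theorem card_minWtC_eq_of_le {w : ℕ} (hw : w ≤ 3) :
    Nat.card {q : (Fin 23 → ZMod 2) ⧸ golayC // minWtC q = w} = Nat.choose 23 w := by
  have hcard := card_hammingNorm_eq (ι := Fin 23) w
  rw [Fintype.card_fin] at hcard
  rw [← hcard]
  have hmin (e : {e : Fin 23 → ZMod 2 // hammingNorm e = w}) :
      minWtC (Submodule.Quotient.mk e.1) = w := by
    rw [minWtC_mk (by lia), e.2]
  refine (Nat.card_eq_of_bijective (fun e => ⟨Submodule.Quotient.mk e.1, hmin e⟩) ⟨?_, ?_⟩).symm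
  · intro e e' h
    exact Subtype.ext (eq_of_mk_eq (congrArg Subtype.val h) (by lia))
  · rintro ⟨q, hq⟩
    obtain ⟨e, he, rfl | rfl⟩ := exists_leader q
    · exact ⟨⟨e, by rwa [minWtC_mk he] at hq⟩, rfl⟩
    · rw [minWtC_mk_one_add he] at hq
      lia

theorem card_minWtC_eq_seven_sub {w : ℕ} (hw : w ≤ 3) :
    Nat.card {q : (Fin 23 → ZMod 2) ⧸ golayC // minWtC q = 7 - w} = Nat.choose 23 w := by
  have hcard := card_hammingNorm_eq (ι := Fin 23) w
  rw [Fintype.card_fin] at hcard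
  rw [← hcard]
  have hmin (e : {e : Fin 23 → ZMod 2 // hammingNorm e = w}) :
      minWtC (Submodule.Quotient.mk (1 + e.1)) = 7 - w := by
    rw [minWtC_mk_one_add (by lia), e.2]
  refine (Nat.card_eq_of_bijective (fun e => ⟨Submodule.Quotient.mk (1 + e.1), hmin e⟩)
    ⟨?_, ?_⟩).symm
  · intro e e' h
    have h := congrArg Subtype.val h
    simp only [Submodule.Quotient.mk_add, add_right_inj] at h
    exact Subtype.ext (eq_of_mk_eq h (by lia))
  · rintro ⟨q, hq⟩
    obtain ⟨e, he, rfl | rfl⟩ := exists_leader q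
    · rw [minWtC_mk he] at hq
      lia
    · exact ⟨⟨e, by rw [minWtC_mk_one_add he] at hq; lia⟩, rfl⟩

theorem stmt_15 :
    (∀ w : Fin 8,
      Nat.card {q : (Fin 23 → ZMod 2) ⧸ golayC // minWtC q = (w : ℕ)} =
        ![1, 23, 253, 1771, 1771, 253, 23, 1] w) ∧
    (∀ q : (Fin 23 → ZMod 2) ⧸ golayC, minWtC q ≤ 7) := by
  refine ⟨fun w => ?_, fun q => ?_⟩
  · fin_cases w
    · exact card_minWtC_eq_of_le (w := 0) (by lia)
    · exact card_minWtC_eq_of_le (w := 1) (by lia)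
    · exact card_minWtC_eq_of_le (w := 2) (by lia)
    · exact card_minWtC_eq_of_le (w := 3) (by lia)
    · exact card_minWtC_eq_seven_sub (w := 3) (by lia)
    · exact card_minWtC_eq_seven_sub (w := 2) (by lia)
    · exact card_minWtC_eq_seven_sub (w := 1) (by lia)
    · exact card_minWtC_eq_seven_sub (w := 0) (by lia)
  · obtain ⟨e, he, rfl | rfl⟩ := exists_leader q
    · rw [minWtC_mk he]
      lia
    · rw [minWtC_mk_one_add he]
      lia
end

section
/- Let G ≤ S₂₃ be the group generated by the two permutations σ and τ specified in the context. Then G acts 4-transitively on {0,…,22}: for any two 4-tuples (a₁,a₂,a₃,a₄) and (b₁,b₂,b₃,b₄) of pairwise distinct elements of {0,…,22}, there exists g ∈ G with g(aᵢ) = bᵢ for i = 1,2,3,4. -/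
/-- The cyclic shift i ↦ i + 1 (mod 23). -/
def golaySigma : Equiv.Perm (Fin 23) := Equiv.addRight (1 : Fin 23)

/-- The permutation (2,16,9,6,8)(3,12,13,18,4)(7,17,10,11,22)(14,19,21,20,15). -/
def golayTau : Equiv.Perm (Fin 23) :=
  ([2, 16, 9, 6, 8] : List (Fin 23)).formPerm *
    ([3, 12, 13, 18, 4] : List (Fin 23)).formPerm *
    ([7, 17, 10, 11, 22] : List (Fin 23)).formPerm *
    ([14, 19, 21, 20, 15] : List (Fin 23)).formPerm

/-- The Mathieu group M₂₃ as the subgroup generated by σ and τ. -/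
def golayGroup : Subgroup (Equiv.Perm (Fin 23)) := Subgroup.closure {golaySigma, golayTau}

theorem golaySigma_mem : golaySigma ∈ golayGroup :=
  Subgroup.subset_closure (Set.mem_insert _ _)

theorem golayTau_mem : golayTau ∈ golayGroup :=
  Subgroup.subset_closure (Set.mem_insert_of_mem _ rfl)

/-- An element of the stabilizer of `5`. -/
def golayFixOne : Equiv.Perm (Fin 23) :=
  golaySigma ^ 3 * golayTau ^ 2 * golaySigma * golayTau ^ 3

/-- An element of the pointwise stabilizer of `{5, 0}`. -/
def golayFixTwo : Equiv.Perm (Fin 23) :=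
  golaySigma ^ 17 * golayTau ^ 3 * golaySigma ^ 2 * golayTau ^ 3

/-- An element of the pointwise stabilizer of `{5, 0, 1}`. -/
def golayFixThree : Equiv.Perm (Fin 23) :=
  golaySigma ^ 14 * golayTau ^ 3 * golaySigma ^ 19 * golayTau * golaySigma ^ 3 * golayTau

theorem golayFixOne_mem : golayFixOne ∈ golayGroup :=
  mul_mem (mul_mem (mul_mem (pow_mem golaySigma_mem _) (pow_mem golayTau_mem _)) golaySigma_mem)
    (pow_mem golayTau_mem _)

theorem golayFixTwo_mem : golayFixTwo ∈ golayGroup :=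
  mul_mem (mul_mem (mul_mem (pow_mem golaySigma_mem _) (pow_mem golayTau_mem _)) (pow_mem golaySigma_mem _))
    (pow_mem golayTau_mem _)

theorem golayFixThree_mem : golayFixThree ∈ golayGroup :=
  mul_mem (mul_mem (mul_mem (mul_mem (mul_mem (pow_mem golaySigma_mem _) (pow_mem golayTau_mem _))
    (pow_mem golaySigma_mem _)) golayTau_mem) (pow_mem golaySigma_mem _)) golayTau_mem

theorem golayTau_apply : ⇑golayTau =
    ![0, 1, 16, 12, 3, 5, 8, 17, 2, 6, 11, 22, 13, 18, 19, 14, 9, 10, 4, 21, 15, 20, 7] := by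
  decide +kernel

theorem golayFixOne_apply : ⇑golayFixOne =
    ![4, 12, 13, 0, 1, 5, 14, 21, 2, 16, 19, 6, 8, 15, 18, 20, 11, 3, 7, 9, 17, 22, 10] := by
  decide +kernel

theorem golayFixTwo_apply : ⇑golayFixTwo =
    ![0, 12, 3, 13, 15, 5, 6, 20, 11, 7, 19, 9, 10, 22, 4, 17, 1, 18, 14, 16, 8, 2, 21] := by
  decide +kernel

theorem golayFixThree_apply : ⇑golayFixThree =
    ![0, 1, 13, 21, 4, 5, 3, 8, 15, 20, 12, 18, 19, 22, 9, 7, 16, 11, 17, 10, 14, 6, 2] := by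
  decide +kernel

theorem exists_golayGroup_apply_eq_five (x : Fin 23) : ∃ g ∈ golayGroup, g x = 5 := by
  have h : ∀ x : Fin 23, ∃ i : Fin 23, (golaySigma ^ (i : ℕ)) x = 5 := by decide +kernel
  obtain ⟨i, hi⟩ := h x
  exact ⟨_, pow_mem golaySigma_mem _, hi⟩

/-- An identity `τ^i (u^j (τ^k x)) = p` yields a group element sending `x` to `p` that fixes every
common fixed point of `τ` and `u`. -/
theorem exists_golayGroup_of_iterate {u : Equiv.Perm (Fin 23)} (hu : u ∈ golayGroup)
    {x p : Fin 23} {i j k : ℕ} (h : golayTau^[i] (u^[j] (golayTau^[k] x)) = p) :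
    ∃ g ∈ golayGroup, g x = p ∧ ∀ y, golayTau y = y → u y = y → g y = y := by
  refine ⟨golayTau ^ i * u ^ j * golayTau ^ k,
    mul_mem (mul_mem (pow_mem golayTau_mem _) (pow_mem hu _)) (pow_mem golayTau_mem _), ?_, ?_⟩
  · simpa [Equiv.Perm.mul_apply, Equiv.Perm.iterate_eq_pow] using h
  · intro y ht hy
    simp only [Equiv.Perm.mul_apply, ← Equiv.Perm.iterate_eq_pow,
      Function.iterate_fixed ht, Function.iterate_fixed hy]

theorem exists_golayGroup_apply_eq_zero {x : Fin 23} (h5 : x ≠ 5) :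
    ∃ g ∈ golayGroup, g x = 0 ∧ g 5 = 5 := by
  have h : ∀ x : Fin 23, x ≠ 5 → ∃ k : Fin 5, ∃ j : Fin 11,
      golayTau^[0] (golayFixOne^[j] (golayTau^[k] x)) = 0 := by
    rw [golayTau_apply, golayFixOne_apply]
    decide +kernel
  obtain ⟨k, j, hx⟩ := h x h5
  obtain ⟨g, hg, hgx, hfix⟩ := exists_golayGroup_of_iterate golayFixOne_mem hx
  exact ⟨g, hg, hgx, hfix 5 (by rw [golayTau_apply]; rfl) (by rw [golayFixOne_apply]; rfl)⟩

theorem exists_golayGroup_apply_eq_one {x : Fin 23} (h5 : x ≠ 5) (h0 : x ≠ 0) :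
    ∃ g ∈ golayGroup, g x = 1 ∧ g 5 = 5 ∧ g 0 = 0 := by
  have h : ∀ x : Fin 23, x ≠ 5 → x ≠ 0 → ∃ k j : Fin 5,
      golayTau^[0] (golayFixTwo^[j] (golayTau^[k] x)) = 1 := by
    rw [golayTau_apply, golayFixTwo_apply]
    decide +kernel
  obtain ⟨k, j, hx⟩ := h x h5 h0
  obtain ⟨g, hg, hgx, hfix⟩ := exists_golayGroup_of_iterate golayFixTwo_mem hx
  exact ⟨g, hg, hgx, hfix 5 (by rw [golayTau_apply]; rfl) (by rw [golayFixTwo_apply]; rfl),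
    hfix 0 (by rw [golayTau_apply]; rfl) (by rw [golayFixTwo_apply]; rfl)⟩

theorem exists_golayGroup_apply_eq_two {x : Fin 23} (h5 : x ≠ 5) (h0 : x ≠ 0) (h1 : x ≠ 1) :
    ∃ g ∈ golayGroup, g x = 2 ∧ g 5 = 5 ∧ g 0 = 0 ∧ g 1 = 1 := by
  have h : ∀ x : Fin 23, x ≠ 5 → x ≠ 0 → x ≠ 1 → ∃ k : Fin 5, ∃ j : Fin 3, ∃ i : Fin 5,
      golayTau^[i] (golayFixThree^[j] (golayTau^[k] x)) = 2 := by
    rw [golayTau_apply, golayFixThree_apply]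
    decide +kernel
  obtain ⟨k, j, i, hx⟩ := h x h5 h0 h1
  obtain ⟨g, hg, hgx, hfix⟩ := exists_golayGroup_of_iterate golayFixThree_mem hx
  exact ⟨g, hg, hgx, hfix 5 (by rw [golayTau_apply]; rfl) (by rw [golayFixThree_apply]; rfl),
    hfix 0 (by rw [golayTau_apply]; rfl) (by rw [golayFixThree_apply]; rfl),
    hfix 1 (by rw [golayTau_apply]; rfl) (by rw [golayFixThree_apply]; rfl)⟩

/-- Every injective 4-tuple can be moved by the group to the tuple `(5, 0, 1, 2)`. -/
theorem exists_golayGroup_apply_eq_base (a : Fin 4 → Fin 23) (ha : Function.Injective a) :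
    ∃ g ∈ golayGroup, ∀ i, g (a i) = (![5, 0, 1, 2] : Fin 4 → Fin 23) i := by
  obtain ⟨g, hg, hg0⟩ := exists_golayGroup_apply_eq_five (a 0)
  obtain ⟨h, hh, hh1, hh5⟩ := exists_golayGroup_apply_eq_zero (x := g (a 1)) (by
    rw [← hg0]
    exact (g.injective.comp ha).ne (by decide))
  have e0 : h (g (a 0)) = 5 := by rw [hg0, hh5]
  obtain ⟨k, hk, hk2, hk5, hk0⟩ := exists_golayGroup_apply_eq_one (x := h (g (a 2)))
    (by rw [← e0]; exact (h.injective.comp (g.injective.comp ha)).ne (by decide))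
    (by rw [← hh1]; exact (h.injective.comp (g.injective.comp ha)).ne (by decide))
  have f0 : k (h (g (a 0))) = 5 := by rw [e0, hk5]
  have f1 : k (h (g (a 1))) = 0 := by rw [hh1, hk0]
  have inj := k.injective.comp (h.injective.comp (g.injective.comp ha))
  obtain ⟨l, hl, hl3, hl5, hl0, hl1⟩ := exists_golayGroup_apply_eq_two (x := k (h (g (a 3))))
    (by rw [← f0]; exact inj.ne (by decide))
    (by rw [← f1]; exact inj.ne (by decide))
    (by rw [← hk2]; exact inj.ne (by decide))
  refine ⟨l * k * h * g, mul_mem (mul_mem (mul_mem hl hk) hh) hg, ?_⟩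
  simp [Fin.forall_fin_succ, Equiv.Perm.mul_apply, f0, f1, hk2, hl3, hl5, hl0, hl1]

theorem stmt_18 :
    ∀ a b : Fin 4 → Fin 23, Function.Injective a → Function.Injective b →
      ∃ g ∈ golayGroup, ∀ i : Fin 4, g (a i) = b i := by
  intro a b ha hb
  obtain ⟨g, hg, hga⟩ := exists_golayGroup_apply_eq_base a ha
  obtain ⟨h, hh, hhb⟩ := exists_golayGroup_apply_eq_base b hb
  refine ⟨h⁻¹ * g, mul_mem (inv_mem hh) hg, fun i => ?_⟩
  rw [Equiv.Perm.mul_apply, hga, ← hhb]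
  exact h.symm_apply_apply (b i)
end
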